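/- Every cubic graph on 2n vertices (n ≥ 1) can be transformed by a finite sequence of Whitehead moves into an (n, n+1)-cubic tree, i.e., into a cubic graph on 2n vertices whose only cycles are loops, having exactly n+1 loops attached to the vertices of an underlying tree. -/

import Mathlib

/-! Cubic multigraphs in the dart (half-edge) model, Whitehead moves,
and the "graph of graphs" `Γ_n`. -/

/-- A cubic multigraph on the `2 * n` vertices `Fin (2 * n)`, in the dart (half-edge) model:
darts are `Fin (6 * n)`, `dinv` is the fixed-point-free involution exchanging the two darts of
each edge, and `vert` assigns to each dart its base vertex.  Loops and multiple edges are
allowed; `regular` says every vertex carries exactly three darts. -/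
structure CubicGraph (n : ℕ) where
  vert : Fin (6 * n) → Fin (2 * n)
  dinv : Fin (6 * n) → Fin (6 * n)
  dinv_invol : ∀ d, dinv (dinv d) = d
  dinv_ne : ∀ d, dinv d ≠ d
  regular : ∀ v : Fin (2 * n), (Finset.univ.filter fun d => vert d = v).card = 3

namespace CubicGraph

variable {n : ℕ}

/-- Two darts are joined if they can be connected by a chain of
"same vertex" / "other half of the same edge" steps. -/
def Reach (g : CubicGraph n) : Fin (6 * n) → Fin (6 * n) → Prop :=
  Relation.ReflTransGen fun a b => g.vert a = g.vert b ∨ g.dinv a = b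

/-- Connectivity of a cubic multigraph. -/
def Connected (g : CubicGraph n) : Prop := ∀ d d', g.Reach d d'

/-- The edge of the dart `d` is a loop. -/
def IsLoop (g : CubicGraph n) (d : Fin (6 * n)) : Prop := g.vert (g.dinv d) = g.vert d

instance (g : CubicGraph n) (d : Fin (6 * n)) : Decidable (g.IsLoop d) :=
  inferInstanceAs (Decidable (_ = _))

lemma card_filter_comp_swap (g : CubicGraph n) (q r : Fin (6 * n)) (v : Fin (2 * n)) :
    (Finset.univ.filter fun d => g.vert (Equiv.swap q r d) = v).card
      = (Finset.univ.filter fun d => g.vert d = v).card := by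
  refine Finset.card_bij (fun d _ => Equiv.swap q r d) ?_ ?_ ?_
  · intro a ha
    simp only [Finset.mem_filter, Finset.mem_univ, true_and] at ha ⊢
    exact ha
  · intro a _ b _ h
    exact (Equiv.swap q r).injective h
  · intro b hb
    simp only [Finset.mem_filter, Finset.mem_univ, true_and] at hb
    exact ⟨Equiv.swap q r b, by simp [hb], by simp⟩

/-- Exchange the base vertices of the two darts `q` and `r`, keeping everything else. -/
def swapDarts (g : CubicGraph n) (q r : Fin (6 * n)) : CubicGraph n where
  vert := fun d => g.vert (Equiv.swap q r d)
  dinv := g.dinv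
  dinv_invol := g.dinv_invol
  dinv_ne := g.dinv_ne
  regular := fun v => (g.card_filter_comp_swap q r v).trans (g.regular v)

/-- The darts based at the same vertex as `x`, other than `x` itself. -/
def othersAt (g : CubicGraph n) (x : Fin (6 * n)) : Finset (Fin (6 * n)) :=
  (Finset.univ.filter fun d => g.vert d = g.vert x).erase x

lemma othersAt_nonempty (g : CubicGraph n) (x : Fin (6 * n)) :
    (g.othersAt x).Nonempty := by
  have hx : x ∈ Finset.univ.filter fun d => g.vert d = g.vert x := by simp
  have h : (g.othersAt x).card = 2 := by
    rw [othersAt, Finset.card_erase_of_mem hx, g.regular]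
  rw [← Finset.card_pos, h]
  norm_num

def oMin (g : CubicGraph n) (x : Fin (6 * n)) : Fin (6 * n) :=
  (g.othersAt x).min' (g.othersAt_nonempty x)

def oMax (g : CubicGraph n) (x : Fin (6 * n)) : Fin (6 * n) :=
  (g.othersAt x).max' (g.othersAt_nonempty x)

/-- The two Whitehead moves (indexed by `i : Fin 2`) performed on the edge containing the dart
`x`.  On a loop the move leaves the graph unchanged; on a non-loop edge the two darts at the
endpoints of the edge other than the edge's own darts are re-attached in one of the two
possible new ways (realized by transporting one dart from each endpoint to the other). -/
def wh (g : CubicGraph n) (i : Fin 2) (x : Fin (6 * n)) : CubicGraph n :=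
  if g.IsLoop x then g
  else if i = 0 then g.swapDarts (g.oMax x) (g.oMin (g.dinv x))
  else g.swapDarts (g.oMax x) (g.oMax (g.dinv x))

/-- An isomorphism of cubic multigraphs: a bijection of darts together with a compatible
bijection of vertices, commuting with the edge involutions. -/
structure Iso (g₁ g₂ : CubicGraph n) where
  dartEquiv : Fin (6 * n) ≃ Fin (6 * n)
  vertEquiv : Fin (2 * n) ≃ Fin (2 * n)
  map_dinv : ∀ d, g₂.dinv (dartEquiv d) = dartEquiv (g₁.dinv d)
  map_vert : ∀ d, g₂.vert (dartEquiv d) = vertEquiv (g₁.vert d)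

def IsIsomorphic (g₁ g₂ : CubicGraph n) : Prop := Nonempty (Iso g₁ g₂)

/-- Reachability avoiding the edge of the dart `x` (i.e. in the graph with that edge removed). -/
def ReachAvoiding (g : CubicGraph n) (x : Fin (6 * n)) :
    Fin (6 * n) → Fin (6 * n) → Prop :=
  Relation.ReflTransGen fun a b =>
    g.vert a = g.vert b ∨ (g.dinv a = b ∧ a ≠ x ∧ a ≠ g.dinv x)

/-- The edge of `x` is a bridge: removing it disconnects the graph. -/
def IsBridge (g : CubicGraph n) (x : Fin (6 * n)) : Prop :=
  ¬ ∀ d d', g.ReachAvoiding x d d'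

/-- A (connected) graph is bridged if it has at least one bridge. -/
def Bridged (g : CubicGraph n) : Prop := ∃ x, g.IsBridge x

/-- A graph is bridgeless if it has no bridge. -/
def Bridgeless (g : CubicGraph n) : Prop := ∀ x, ¬ g.IsBridge x

/-- `c` lists consecutive darts of a cycle of length `k`: the vertices visited are pairwise
distinct, the end of each dart's edge is the base of the next one (cyclically), and the `k`
edges used are pairwise distinct. -/
def IsCycle (g : CubicGraph n) (k : ℕ) (c : Fin k → Fin (6 * n)) : Prop :=
  (∀ i : Fin k,
    g.vert (g.dinv (c i)) = g.vert (c ⟨(i.1 + 1) % k, Nat.mod_lt _ i.pos⟩)) ∧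
  Function.Injective (fun i => g.vert (c i)) ∧
  ∀ i j : Fin k, c j ≠ g.dinv (c i)

/-- The cycle `c` is indecomposable (induced): no edge of `g` other than the cycle's own
edges joins two vertices of the cycle. -/
def Indecomposable (g : CubicGraph n) (k : ℕ) (c : Fin k → Fin (6 * n)) : Prop :=
  ∀ d, (∃ i, g.vert d = g.vert (c i)) → (∃ j, g.vert (g.dinv d) = g.vert (c j)) →
    ∃ i, d = c i ∨ d = g.dinv (c i)

/-- The girth: the least length of a cycle. -/
noncomputable def girth (g : CubicGraph n) : ℕ :=
  sInf {k | 0 < k ∧ ∃ c : Fin k → Fin (6 * n), g.IsCycle k c}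

/-- The only cycles of the graph are loops. -/
def OnlyLoopCycles (g : CubicGraph n) : Prop :=
  ∀ k, 2 ≤ k → ∀ c : Fin k → Fin (6 * n), ¬ g.IsCycle k c

/-- The number of darts lying on loops (each loop contributes two darts). -/
def loopCount (g : CubicGraph n) : ℕ :=
  (Finset.univ.filter fun d => g.IsLoop d).card

end CubicGraph

instance {n : ℕ} : Finite (CubicGraph n) := by
  have hinj : Function.Injective fun g : CubicGraph n => (g.vert, g.dinv) := by
    rintro ⟨v₁, i₁, _, _, _⟩ ⟨v₂, i₂, _, _, _⟩ h
    simp only [Prod.mk.injEq] at h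
    obtain ⟨h₁, h₂⟩ := h
    subst h₁; subst h₂; rfl
  exact Finite.of_injective _ hinj

/-- Isomorphism of connected cubic graphs. -/
def cgIso {n : ℕ} (g₁ g₂ : {g : CubicGraph n // g.Connected}) : Prop :=
  CubicGraph.IsIsomorphic g₁.1 g₂.1

/-- The vertex set of the graph of graphs `Γ_n`: isomorphism classes of connected cubic
multigraphs on `2 * n` vertices. -/
abbrev GammaV (n : ℕ) := Quot (@cgIso n)

/-- The number of directed edges of `Γ_n` from the class `u` to the class `v`: one edge for
each Whitehead move of a representative of `u` whose result lies in the class `v`.  A move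
specification is a pair `(i, x)` of a move type `i : Fin 2` and a dart `x`; each of the two
Whitehead moves of each edge is counted by exactly two specifications (one for each of the
two darts of the edge), whence the division by `2`. -/
noncomputable def edgeMult (n : ℕ) (u v : GammaV n) : ℕ :=
  Nat.card {p : Fin 2 × Fin (6 * n) //
    CubicGraph.IsIsomorphic ((Quot.out u).1.wh p.1 p.2) (Quot.out v).1} / 2

/-- The sum of out-degrees of the classes in `S` (every class has out-degree `6 * n`:
two Whitehead moves for each of the `3 * n` edges). -/
noncomputable def dOut (n : ℕ) (S : Set (GammaV n)) : ℕ :=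
  Nat.card {q : GammaV n × Fin 2 × Fin (6 * n) // q.1 ∈ S} / 2

/-- The number of directed edges of `Γ_n` from `S` to its complement. -/
noncomputable def boundaryCount (n : ℕ) (S : Set (GammaV n)) : ℕ :=
  Nat.card {q : GammaV n × Fin 2 × Fin (6 * n) // q.1 ∈ S ∧
    ∀ v : GammaV n,
      CubicGraph.IsIsomorphic ((Quot.out q.1).1.wh q.2.1 q.2.2) (Quot.out v).1 → v ∉ S} / 2

/-- The outer conductance of a set `S` of vertices of `Γ_n`. -/
noncomputable def phiOutSet (n : ℕ) (S : Set (GammaV n)) : ℝ :=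
  (boundaryCount n S : ℝ) / min (dOut n S : ℝ) (dOut n Sᶜ : ℝ)

/-- The outer conductance of `Γ_n`: the infimum of the outer conductances of nonempty
proper subsets of vertices. -/
noncomputable def phiOut (n : ℕ) : ℝ :=
  sInf {x : ℝ | ∃ S : Set (GammaV n), S.Nonempty ∧ Sᶜ.Nonempty ∧ x = phiOutSet n S}

/-- The set of classes of bridged cubic graphs. -/
def bridgedSet (n : ℕ) : Set (GammaV n) := {u | (Quot.out u).1.Bridged}

namespace CubicGraph

variable {n : ℕ}

/-- One Whitehead move leads from `a` to `b`. -/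
def WhiteheadStep (a b : CubicGraph n) : Prop :=
  ∃ (i : Fin 2) (x : Fin (6 * n)), b = a.wh i x

section Darts

variable (g : CubicGraph n) {x d e : Fin (6 * n)}

lemma mem_othersAt : d ∈ g.othersAt x ↔ d ≠ x ∧ g.vert d = g.vert x := by
  simp [othersAt]

lemma card_othersAt (x : Fin (6 * n)) : (g.othersAt x).card = 2 := by
  rw [othersAt, Finset.card_erase_of_mem (by simp), g.regular]

lemma oMin_mem (x : Fin (6 * n)) : g.oMin x ∈ g.othersAt x := Finset.min'_mem _ _

lemma oMax_mem (x : Fin (6 * n)) : g.oMax x ∈ g.othersAt x := Finset.max'_mem _ _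

lemma eq_or_eq_of_mem_othersAt {y : Fin (6 * n)} (hd : d ∈ g.othersAt x)
    (he : e ∈ g.othersAt x) (hy : y ∈ g.othersAt x) (hde : d ≠ e) : y = d ∨ y = e := by
  have hsub : ({d, e} : Finset (Fin (6 * n))) ⊆ g.othersAt x := by
    simp [Finset.insert_subset_iff, hd, he]
  have := Finset.eq_of_subset_of_card_le hsub
    (by rw [card_othersAt, Finset.card_pair hde])
  rw [← this] at hy
  simpa using hy

lemma oMin_ne_oMax (x : Fin (6 * n)) : g.oMin x ≠ g.oMax x :=
  (Finset.min'_lt_max'_of_card _ (by rw [card_othersAt]; norm_num)).ne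

lemma exists_vert_eq (v : Fin (2 * n)) : ∃ d, g.vert d = v := by
  have h : 0 < (Finset.univ.filter fun d => g.vert d = v).card := by
    rw [g.regular]; norm_num
  obtain ⟨d, hd⟩ := Finset.card_pos.1 h
  exact ⟨d, by simpa using hd⟩

lemma isLoop_dinv : g.IsLoop (g.dinv d) ↔ g.IsLoop d := by
  simp only [IsLoop, g.dinv_invol, eq_comm]

/-- A loop based at the base of a non-loop dart `x` uses both other darts there. -/
lemma isLoop_of_mem_othersAt (hx : ¬ g.IsLoop x) (hd : g.IsLoop d) (hdx : g.vert d = g.vert x)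
    (he : e ∈ g.othersAt x) : g.IsLoop e := by
  have h₁ : d ∈ g.othersAt x := g.mem_othersAt.2 ⟨fun h => hx (h ▸ hd), hdx⟩
  have h₂ : g.dinv d ∈ g.othersAt x :=
    g.mem_othersAt.2 ⟨fun h => hx (h ▸ g.isLoop_dinv.2 hd), hd.trans hdx⟩
  rcases g.eq_or_eq_of_mem_othersAt h₁ h₂ he (g.dinv_ne d).symm with rfl | rfl
  · exact hd
  · exact g.isLoop_dinv.2 hd

end Darts

section Swap

variable (g : CubicGraph n) {x q r d : Fin (6 * n)}

lemma swapDarts_vert_left (q r : Fin (6 * n)) : (g.swapDarts q r).vert q = g.vert r := by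
  simp [swapDarts]

lemma swapDarts_vert_right (q r : Fin (6 * n)) : (g.swapDarts q r).vert r = g.vert q := by
  simp [swapDarts]

lemma swapDarts_vert_of_ne (hq : d ≠ q) (hr : d ≠ r) :
    (g.swapDarts q r).vert d = g.vert d := by
  simp [swapDarts, Equiv.swap_apply_of_ne_of_ne hq hr]

lemma swapDarts_vert_of_vert_ne (hq : g.vert d ≠ g.vert q) (hr : g.vert d ≠ g.vert r) :
    (g.swapDarts q r).vert d = g.vert d :=
  g.swapDarts_vert_of_ne (fun h => hq (h ▸ rfl)) (fun h => hr (h ▸ rfl))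

lemma swapDarts_vert_mem (h : g.vert d = g.vert q ∨ g.vert d = g.vert r) :
    (g.swapDarts q r).vert d = g.vert q ∨ (g.swapDarts q r).vert d = g.vert r := by
  by_cases hq : d = q
  · subst hq; exact Or.inr (g.swapDarts_vert_left d r)
  by_cases hr : d = r
  · subst hr; exact Or.inl (g.swapDarts_vert_right q d)
  rwa [g.swapDarts_vert_of_ne hq hr]

lemma Reach.symm {g : CubicGraph n} {d e : Fin (6 * n)} (h : g.Reach d e) : g.Reach e d := by
  induction h with
  | refl => exact .refl
  | tail _ h ih =>
    refine .head ?_ ih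
    rcases h with h | rfl
    · exact Or.inl h.symm
    · exact Or.inr (g.dinv_invol _)

lemma Connected.swapDarts {g : CubicGraph n} (hg : g.Connected) (hx : ¬ g.IsLoop x)
    (hq : q ∈ g.othersAt x) (hr : r ∈ g.othersAt (g.dinv x)) :
    (g.swapDarts q r).Connected := by
  obtain ⟨hqx, hqv⟩ := g.mem_othersAt.1 hq
  obtain ⟨hrx, hrv⟩ := g.mem_othersAt.1 hr
  have hxv : (g.swapDarts q r).vert x = g.vert q := by
    rw [g.swapDarts_vert_of_ne hqx.symm (fun h => hx ?_), hqv]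
    rw [IsLoop, ← hrv, ← h]
  have hxv' : (g.swapDarts q r).vert (g.dinv x) = g.vert r := by
    rw [g.swapDarts_vert_of_ne (fun h => hx ?_) hrx.symm, hrv]
    rw [IsLoop, h, hqv]
  have key : ∀ d, g.vert d = g.vert q ∨ g.vert d = g.vert r → (g.swapDarts q r).Reach d x := by
    intro d hd
    rcases g.swapDarts_vert_mem hd with h | h
    · exact .single (Or.inl (h.trans hxv.symm))
    · exact .head (b := g.dinv x) (Or.inl (h.trans hxv'.symm))
        (.single (Or.inr (g.dinv_invol x)))
  have step : ∀ a b, g.vert a = g.vert b ∨ g.dinv a = b → (g.swapDarts q r).Reach a b := by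
    rintro a b (h | h)
    · by_cases ha : g.vert a = g.vert q ∨ g.vert a = g.vert r
      · exact (key a ha).trans (key b (h ▸ ha)).symm
      · have hb : ¬ (g.vert b = g.vert q ∨ g.vert b = g.vert r) := h ▸ ha
        push Not at ha hb
        refine .single (Or.inl ?_)
        rw [g.swapDarts_vert_of_vert_ne ha.1 ha.2, g.swapDarts_vert_of_vert_ne hb.1 hb.2, h]
    · exact .single (Or.inr h)
  intro d d'
  have h := hg d d'
  induction h with
  | refl => exact .refl
  | tail _ h ih => exact ih.trans (step _ _ h)

lemma Connected.wh {g : CubicGraph n} (hg : g.Connected) (i : Fin 2) (x : Fin (6 * n)) :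
    (g.wh i x).Connected := by
  unfold CubicGraph.wh
  split_ifs with h₁ h₂
  · exact hg
  · exact hg.swapDarts h₁ (g.oMax_mem x) (g.oMin_mem _)
  · exact hg.swapDarts h₁ (g.oMax_mem x) (g.oMax_mem _)

lemma Connected.of_whiteheadSteps {g t : CubicGraph n} (hg : g.Connected)
    (h : Relation.ReflTransGen WhiteheadStep g t) : t.Connected := by
  induction h with
  | refl => exact hg
  | tail _ h ih =>
    obtain ⟨i, x, rfl⟩ := h
    exact ih.wh i x

/-- Any prescribed dart `a` at one end and `c` at the other end of a non-loop edge can be brought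
together by a Whitehead move. -/
lemma exists_wh_eq_swapDarts {a c : Fin (6 * n)} (hx : ¬ g.IsLoop x) (ha : a ∈ g.othersAt x)
    (hc : c ∈ g.othersAt (g.dinv x)) :
    ∃ i, ∃ q ∈ g.othersAt x, ∃ r ∈ g.othersAt (g.dinv x), g.wh i x = g.swapDarts q r ∧
      (g.swapDarts q r).vert a = (g.swapDarts q r).vert c := by
  have hw : ∀ r, r = g.oMin (g.dinv x) ∨ r = g.oMax (g.dinv x) →
      ∃ i, g.wh i x = g.swapDarts (g.oMax x) r := by
    rintro r (rfl | rfl)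
    · exact ⟨0, by simp [CubicGraph.wh, hx]⟩
    · exact ⟨1, by simp [CubicGraph.wh, hx]⟩
  have hex : ∀ d ∈ g.othersAt (g.dinv x), ∃ r ∈ g.othersAt (g.dinv x), r ≠ d := by
    intro d hd
    by_cases h : g.oMin (g.dinv x) = d
    · exact ⟨_, g.oMax_mem _, fun h' => g.oMin_ne_oMax _ (h.trans h'.symm)⟩
    · exact ⟨_, g.oMin_mem _, h⟩
  have hval : ∀ r ∈ g.othersAt (g.dinv x), r = g.oMin (g.dinv x) ∨ r = g.oMax (g.dinv x) :=
    fun r hr => g.eq_or_eq_of_mem_othersAt (g.oMin_mem _) (g.oMax_mem _) hr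
      (g.oMin_ne_oMax _)
  have hne : ∀ d ∈ g.othersAt x, ∀ e ∈ g.othersAt (g.dinv x), d ≠ e := by
    rintro d hd e he rfl
    exact hx ((g.mem_othersAt.1 he).2.symm.trans (g.mem_othersAt.1 hd).2)
  by_cases h : a = g.oMax x
  · obtain ⟨r, hr, hrc⟩ := hex c hc
    obtain ⟨i, hi⟩ := hw r (hval r hr)
    refine ⟨i, _, g.oMax_mem x, r, hr, hi, ?_⟩
    rw [h, g.swapDarts_vert_left, g.swapDarts_vert_of_ne (hne _ (g.oMax_mem x) _ hc).symm hrc.symm,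
      (g.mem_othersAt.1 hr).2, (g.mem_othersAt.1 hc).2]
  · obtain ⟨i, hi⟩ := hw c (hval c hc)
    refine ⟨i, _, g.oMax_mem x, c, hc, hi, ?_⟩
    rw [g.swapDarts_vert_right, g.swapDarts_vert_of_ne h (hne _ ha _ hc),
      (g.mem_othersAt.1 (g.oMax_mem x)).2, (g.mem_othersAt.1 ha).2]

lemma isLoop_swapDarts {a c : Fin (6 * n)} (hx : ¬ g.IsLoop x)
    (ha : a ∈ g.othersAt x) (hc : c ∈ g.othersAt (g.dinv x)) (hal : ¬ g.IsLoop a)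
    (hcl : ¬ g.IsLoop c) (hq : q ∈ g.othersAt x) (hr : r ∈ g.othersAt (g.dinv x))
    (hd : g.IsLoop d) : (g.swapDarts q r).IsLoop d := by
  have h₁ : g.vert d ≠ g.vert q := fun h =>
    hal (g.isLoop_of_mem_othersAt hx hd (h.trans (g.mem_othersAt.1 hq).2) ha)
  have h₂ : g.vert d ≠ g.vert r := fun h =>
    hcl (g.isLoop_of_mem_othersAt (mt g.isLoop_dinv.1 hx) hd
      (h.trans (g.mem_othersAt.1 hr).2) hc)
  have hd' : g.vert (g.dinv d) = g.vert d := hd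
  change (g.swapDarts q r).vert (g.dinv d) = (g.swapDarts q r).vert d
  rw [g.swapDarts_vert_of_vert_ne h₁ h₂,
    g.swapDarts_vert_of_vert_ne (by rwa [hd']) (by rwa [hd']), hd']

end Swap

section Cycles

variable {g : CubicGraph n}

lemma IsCycle.not_isLoop {m : ℕ} {c : Fin (m + 2) → Fin (6 * n)} (hc : g.IsCycle (m + 2) c)
    (i : Fin (m + 2)) : ¬ g.IsLoop (c i) := by
  intro h
  have h' := hc.2.1 ((hc.1 i).symm.trans h)
  have h'' := congrArg Fin.val h'
  simp only at h''
  have hi := i.2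
  rcases Nat.lt_or_ge (i.1 + 1) (m + 2) with hlt | hge
  · rw [Nat.mod_eq_of_lt hlt] at h''; omega
  · have : i.1 + 1 = m + 2 := by omega
    rw [this, Nat.mod_self] at h''; omega

/-- A Whitehead move on an edge of a cycle of length at least two shortens the cycle by one,
without destroying any loop. -/
lemma IsCycle.exists_whiteheadStep {m : ℕ} {c : Fin (m + 2) → Fin (6 * n)}
    (hc : g.IsCycle (m + 2) c) :
    ∃ g', WhiteheadStep g g' ∧ (∀ d, g.IsLoop d → g'.IsLoop d) ∧
      g'.IsCycle (m + 1) (fun i => c i.castSucc) := by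
  set x := c (Fin.last (m + 1)) with hxdef
  have hx : ¬ g.IsLoop x := hc.not_isLoop _
  have hnext : ∀ i : Fin (m + 1), g.vert (g.dinv (c i.castSucc)) = g.vert (c i.succ) := by
    intro i
    rw [hc.1]
    congr 2
    ext
    simp only [Fin.val_castSucc, Fin.val_succ]
    exact Nat.mod_eq_of_lt (by omega)
  have hlast : g.vert (g.dinv x) = g.vert (c 0) := by
    rw [hxdef, hc.1]
    congr 2
    ext
    simp
  have ha : g.dinv (c (Fin.last m).castSucc) ∈ g.othersAt x :=
    g.mem_othersAt.2 ⟨(hc.2.2 _ _).symm, by rw [hnext, Fin.succ_last]⟩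
  have hc0 : c 0 ∈ g.othersAt (g.dinv x) := g.mem_othersAt.2 ⟨hc.2.2 _ _, hlast.symm⟩
  obtain ⟨i, q, hq, r, hr, hw, hv⟩ := g.exists_wh_eq_swapDarts hx ha hc0
  have hqv : g.vert q = g.vert x := (g.mem_othersAt.1 hq).2
  have hrv : g.vert r = g.vert (c 0) := ((g.mem_othersAt.1 hr).2).trans hlast
  have hout : ∀ d, ∀ i : Fin (m + 2), i ≠ 0 → i ≠ Fin.last (m + 1) → g.vert d = g.vert (c i) →
      (g.swapDarts q r).vert d = g.vert (c i) := by
    intro d i h0 hl hd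
    rw [← hd]
    refine g.swapDarts_vert_of_vert_ne ?_ ?_ <;> rw [hd]
    · rw [hqv]; exact fun h => hl (hc.2.1 h)
    · rw [hrv]; exact fun h => h0 (hc.2.1 h)
  refine ⟨_, ⟨i, x, hw.symm⟩, fun d hd => g.isLoop_swapDarts hx ha hc0
    (mt g.isLoop_dinv.1 (hc.not_isLoop _)) (hc.not_isLoop _) hq hr hd, ?_, ?_, ?_⟩
  · intro i
    change (g.swapDarts q r).vert (g.dinv _) = _
    rcases eq_or_ne i (Fin.last m) with rfl | hi
    · rw [hv]
      congr 2
      ext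
      simp
    · have hi' : i.1 < m := Fin.val_lt_last hi
      have hs : (Fin.castSucc ⟨(i.1 + 1) % (m + 1), Nat.mod_lt _ i.pos⟩) = i.succ := by
        ext
        simp only [Fin.castSucc_mk, Fin.val_succ]
        exact Nat.mod_eq_of_lt (by omega)
      have h0 : i.succ ≠ 0 := Fin.succ_ne_zero i
      have hl : i.succ ≠ Fin.last (m + 1) := by
        intro h
        have := congrArg Fin.val h
        simp at this
        omega
      change (g.swapDarts q r).vert (g.dinv (c i.castSucc)) =
        (g.swapDarts q r).vert (c (Fin.castSucc ⟨(i.1 + 1) % (m + 1), Nat.mod_lt _ i.pos⟩))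
      rw [hs, hout _ _ h0 hl (hnext i), hout _ _ h0 hl rfl]
  · have hzero : ∀ j : Fin (m + 1), j ≠ 0 →
        (g.swapDarts q r).vert (c j.castSucc) ≠ (g.swapDarts q r).vert (c 0) := by
      intro j hj h
      have hj0 : j.castSucc ≠ 0 := by simpa using hj
      have hjl : j.castSucc ≠ Fin.last (m + 1) := (Fin.castSucc_lt_last j).ne
      rw [hout _ _ hj0 hjl rfl] at h
      rcases g.swapDarts_vert_mem (Or.inr hrv.symm : g.vert (c 0) = g.vert q ∨ _) with h' | h'
      · exact hjl (hc.2.1 (h.trans (h'.trans hqv)))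
      · exact hj0 (hc.2.1 (h.trans (h'.trans hrv)))
    intro i j hij
    simp only at hij
    by_cases hi : i = 0
    · by_cases hj : j = 0
      · rw [hi, hj]
      · subst hi
        exact absurd hij.symm (hzero j hj)
    · by_cases hj : j = 0
      · subst hj
        exact absurd hij (hzero i hi)
      · rw [hout _ i.castSucc (by simpa using hi) (Fin.castSucc_lt_last i).ne rfl,
          hout _ j.castSucc (by simpa using hj) (Fin.castSucc_lt_last j).ne rfl] at hij
        exact Fin.castSucc_injective _ (hc.2.1 hij)
  · intro i j
    exact hc.2.2 _ _

lemma loopCount_le {g' : CubicGraph n} (h : ∀ d, g.IsLoop d → g'.IsLoop d) :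
    g.loopCount ≤ g'.loopCount :=
  Finset.card_le_card (Finset.monotone_filter_right _ fun d _ => h d)

lemma IsCycle.exists_loopCount_lt {m : ℕ} :
    ∀ {g : CubicGraph n} {c : Fin (m + 2) → Fin (6 * n)}, g.IsCycle (m + 2) c →
      ∃ g', Relation.ReflTransGen WhiteheadStep g g' ∧ g.loopCount < g'.loopCount := by
  induction m with
  | zero =>
    intro g c hc
    obtain ⟨g', hs, hl, hc'⟩ := hc.exists_whiteheadStep
    refine ⟨g', .single hs, Finset.card_lt_card ⟨Finset.monotone_filter_right _ fun d _ => hl d,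
      fun hsub => hc.not_isLoop 0 ?_⟩⟩
    have h0 : g'.IsLoop (c 0) := hc'.1 0
    have := hsub (Finset.mem_filter.2 ⟨Finset.mem_univ _, h0⟩)
    exact (Finset.mem_filter.1 this).2
  | succ m ih =>
    intro g c hc
    obtain ⟨g', hs, hl, hc'⟩ := hc.exists_whiteheadStep
    obtain ⟨g'', hr, hlt⟩ := ih hc'
    exact ⟨g'', .head hs hr, (loopCount_le hl).trans_lt hlt⟩

lemma exists_onlyLoopCycles (g : CubicGraph n) :
    ∃ t, Relation.ReflTransGen WhiteheadStep g t ∧ t.OnlyLoopCycles := by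
  obtain ⟨t, ht, hmax⟩ :=
    (Set.toFinite {t | Relation.ReflTransGen WhiteheadStep g t}).exists_maximalFor
      loopCount _ ⟨g, .refl⟩
  refine ⟨t, ht, fun k hk c hc => ?_⟩
  obtain ⟨m, rfl⟩ := Nat.exists_eq_add_of_le' hk
  obtain ⟨t', hr, hlt⟩ := hc.exists_loopCount_lt
  exact hlt.not_ge (hmax (ht.trans hr) hlt.le)

end Cycles

section Tree

variable (g : CubicGraph n)

/-- The simple graph obtained by deleting loops and merging parallel edges. -/
def toSimpleGraph : SimpleGraph (Fin (2 * n)) where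
  Adj u v := u ≠ v ∧ ∃ d, g.vert d = u ∧ g.vert (g.dinv d) = v
  symm := ⟨fun _ _ ⟨h, d, hu, hv⟩ => ⟨h.symm, g.dinv d, hv, by rw [g.dinv_invol, hu]⟩⟩
  loopless := ⟨fun _ h => h.1 rfl⟩

variable {g}

lemma Connected.toSimpleGraph_connected (hn : 1 ≤ n) (hg : g.Connected) :
    g.toSimpleGraph.Connected := by
  have : Nonempty (Fin (2 * n)) := ⟨⟨0, by omega⟩⟩
  refine ⟨fun u v => ?_⟩
  obtain ⟨d, rfl⟩ := g.exists_vert_eq u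
  obtain ⟨d', rfl⟩ := g.exists_vert_eq v
  have h := hg d d'
  induction h with
  | refl => exact .rfl
  | @tail b e _ h ih =>
    refine ih.trans ?_
    rcases h with h | rfl
    · rw [h]
    · by_cases hb : g.vert b = g.vert (g.dinv b)
      · rw [← hb]
      · exact SimpleGraph.Adj.reachable ⟨hb, b, rfl, rfl⟩

lemma OnlyLoopCycles.isAcyclic (hg : g.OnlyLoopCycles) : g.toSimpleGraph.IsAcyclic := by
  intro v p hp
  have h3 := hp.three_le_length
  have hex : ∀ i : Fin p.length, ∃ d, g.vert d = p.getVert i ∧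
      g.vert (g.dinv d) = p.getVert (i + 1) := fun i => (p.adj_getVert_succ i.2).2
  choose c hc hc' using hex
  have hmod : ∀ i : Fin p.length, p.getVert ((i.1 + 1) % p.length) = p.getVert (i + 1) := by
    intro i
    rcases Nat.lt_or_ge (i.1 + 1) p.length with h | h
    · rw [Nat.mod_eq_of_lt h]
    · have : i.1 + 1 = p.length := by omega
      rw [this, Nat.mod_self]; simp
  have hinj : Function.Injective fun i => g.vert (c i) := by
    intro i j hij
    simp only [hc] at hij
    exact Fin.ext (hp.getVert_injOn' (by simp; omega) (by simp; omega) hij)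
  have hnext : ∀ i : Fin p.length,
      g.vert (g.dinv (c i)) = g.vert (c ⟨(i.1 + 1) % p.length, Nat.mod_lt _ i.pos⟩) := by
    intro i
    rw [hc', hc, hmod]
  refine hg p.length (by omega) c ⟨hnext, hinj, fun i j hij => ?_⟩
  have h₁ := hinj ((congrArg g.vert hij).trans (hnext i))
  have h₂ := (hnext j).symm.trans (congrArg g.vert ((congrArg g.dinv hij).trans (g.dinv_invol _)))
  have h₁' := congrArg Fin.val h₁
  have h₂' := congrArg Fin.val (hinj h₂)
  simp only at h₁' h₂'
  have hi := i.2
  have hj := j.2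
  rcases Nat.lt_or_ge (i.1 + 1) p.length with h | h <;>
  rcases Nat.lt_or_ge (j.1 + 1) p.length with h' | h'
  · rw [Nat.mod_eq_of_lt h] at h₁'; rw [Nat.mod_eq_of_lt h'] at h₂'; omega
  · rw [Nat.mod_eq_of_lt h] at h₁'
    rw [show j.1 + 1 = p.length by omega, Nat.mod_self] at h₂'; omega
  · rw [show i.1 + 1 = p.length by omega, Nat.mod_self] at h₁'
    rw [Nat.mod_eq_of_lt h'] at h₂'; omega
  · rw [show i.1 + 1 = p.length by omega, Nat.mod_self] at h₁'; omega

/-- Without 2-cycles, a non-loop dart is determined by its two end vertices. -/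
lemma OnlyLoopCycles.dart_ext (hg : g.OnlyLoopCycles) {d e : Fin (6 * n)} (hd : ¬ g.IsLoop d)
    (h : g.vert d = g.vert e) (h' : g.vert (g.dinv d) = g.vert (g.dinv e)) : d = e := by
  by_contra hne
  have hd' : g.vert (g.dinv d) ≠ g.vert d := hd
  refine hg 2 le_rfl ![d, g.dinv e] ⟨?_, ?_, ?_⟩
  · intro i
    fin_cases i
    · exact h'
    · change g.vert (g.dinv (g.dinv e)) = g.vert d
      rw [g.dinv_invol, h]
  · intro i j hij
    fin_cases i <;> fin_cases j <;> simp at hij ⊢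
    · exact hd' (h'.trans hij.symm)
    · exact hd' (h'.trans hij)
  · have hinv : d ≠ g.dinv (g.dinv e) := by rwa [g.dinv_invol]
    have hinv' : g.dinv e ≠ g.dinv d := fun he =>
      hne (by rw [← g.dinv_invol d, ← he, g.dinv_invol])
    intro i j
    fin_cases i <;> fin_cases j
    · exact (g.dinv_ne _).symm
    · exact hinv'
    · exact hinv
    · exact (g.dinv_ne _).symm

lemma OnlyLoopCycles.loopCount_eq (hn : 1 ≤ n) (hg : g.Connected) (ht : g.OnlyLoopCycles) :
    g.loopCount = 2 * (n + 1) := by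
  classical
  have htree : g.toSimpleGraph.IsTree := ⟨hg.toSimpleGraph_connected hn, ht.isAcyclic⟩
  have hedges := htree.card_edgeFinset
  have hdarts := g.toSimpleGraph.dart_card_eq_twice_card_edges
  have hbij : Fintype.card {d // ¬ g.IsLoop d} = Fintype.card g.toSimpleGraph.Dart := by
    refine Fintype.card_of_bijective
      (f := fun d => ⟨(g.vert d.1, g.vert (g.dinv d.1)), Ne.symm d.2, d.1, rfl, rfl⟩) ⟨?_, ?_⟩
    · intro d e h
      have h' := congrArg SimpleGraph.Dart.toProd h
      simp only [Prod.mk.injEq] at h'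
      exact Subtype.ext (ht.dart_ext d.2 h'.1 h'.2)
    · rintro ⟨⟨u, v⟩, hne, d, hu, hv⟩
      obtain rfl : g.vert d = u := hu
      obtain rfl : g.vert (g.dinv d) = v := hv
      exact ⟨⟨d, Ne.symm hne⟩, rfl⟩
  have hsum : g.loopCount + Fintype.card {d // ¬ g.IsLoop d} = 6 * n := by
    rw [Fintype.card_subtype, loopCount]
    convert Finset.card_filter_add_card_filter_not (s := (Finset.univ : Finset (Fin (6 * n))))
      g.IsLoop
    simp
  rw [Fintype.card_fin] at hedges
  omega

end Tree

end CubicGraph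

/-- Every connected cubic graph on `2n` vertices can be transformed by a
finite sequence of Whitehead moves into an `(n, n+1)`-cubic tree: a cubic graph whose only
cycles are loops, with exactly `n + 1` loops (i.e. `2 * (n + 1)` loop darts). -/
theorem reachable_cubic_tree (n : ℕ) (hn : 1 ≤ n) (g : CubicGraph n) (hg : g.Connected) :
    ∃ t : CubicGraph n,
      Relation.ReflTransGen
        (fun a b : CubicGraph n => ∃ (i : Fin 2) (x : Fin (6 * n)), b = a.wh i x) g t ∧
      t.OnlyLoopCycles ∧ t.loopCount = 2 * (n + 1) := by
  obtain ⟨t, hr, ht⟩ := g.exists_onlyLoopCycles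
  exact ⟨t, hr, ht, ht.loopCount_eq hn (hg.of_whiteheadSteps hr)⟩
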